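/- arXiv:0801.3626 — 2 statements merged into one kernel-verified Lean document; each statement's English description precedes it below -/
import Mathlib

section
/- Let L be a finite simplicial complex on vertex set V, k a field, and m : V → ℤ a weight function with gcd{m_v : v ∈ V} = 1, determining an epimorphism χ: G_L ↠ ℤ. Let Λ = k[t, t^{−1}] and γ_v = t^{m_v} − 1 ∈ Λ. Then for all i ≥ 0, the rank of the finitely generated Λ-module H_i(C_•(T_L, Λ_γ)) (which is isomorphic to H_i(T_L^χ, k)) equals β_i(k⟨L⟩, V_0(χ)), where V_0(χ) = {v ∈ V : m_v ≠ 0}. -/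
open Finset

variable {V : Type} [Fintype V] [LinearOrder V]

/-- The set of faces of cardinality `c` of a finite family of finsets `L`
(for a simplicial complex, these index the `(c-1)`-simplices, with the empty
simplex corresponding to `c = 0`). -/
abbrev Face (L : Finset (Finset V)) (c : ℕ) := {σ : Finset V // σ ∈ L ∧ σ.card = c}

/-- `L` is (the face set of) a finite abstract simplicial complex:  it contains the
empty face and is closed under passing to subsets. -/
def IsCx (L : Finset (Finset V)) : Prop :=
  ∅ ∈ L ∧ ∀ σ ∈ L, ∀ τ ⊆ σ, τ ∈ L

/-- Incidence coefficient between a face `τ` and a face `σ` (intended: `τ ⊆ σ` with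
`|σ| = |τ| + 1`), twisted by the weights `z`:  if `σ = τ ∪ {v}` this is
`(-1)^{#{w ∈ τ : w < v}} ⬝ z v`, and `0` if `τ ⊄ σ`. -/
def coeffD {R : Type} [CommRing R] (z : V → R) (τ σ : Finset V) : R :=
  if τ ⊆ σ then ∑ v ∈ σ \ τ, (-1 : R) ^ (τ.filter (fun w => w < v)).card * z v else 0

/-- The boundary map `∂^z : C_{c+1}(T_L, R_z) → C_c(T_L, R_z)` of the twisted cellular
chain complex of the toric complex `T_L`:  on a basis element `c_σ`,
`σ = {v_1 < ⋯ < v_{c+1}}`, it is `∂^z c_σ = ∑ (-1)^{r-1} z_{v_r} c_{σ ∖ {v_r}}`. -/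
noncomputable def tB (R : Type) [CommRing R] (L : Finset (Finset V)) (z : V → R) (c : ℕ) :
    (Face L (c+1) → R) →ₗ[R] (Face L c → R) :=
  Matrix.mulVecLin (fun (τ : Face L c) (σ : Face L (c+1)) => coeffD z τ.1 σ.1)

/-- The Aomoto differential on the exterior Stanley--Reisner ring `k⟨L⟩`:  the degree-`c`
piece of `k⟨L⟩` has basis the faces of cardinality `c`, and right multiplication by
`z = ∑ z_v v*` sends the monomial `e_τ` to `∑_{v : τ ∪ {v} ∈ L} ± z_v e_{τ ∪ {v}}`. -/
noncomputable def aD (k : Type) [Field k] (L : Finset (Finset V)) (z : V → k) (c : ℕ) :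
    (Face L c → k) →ₗ[k] (Face L (c+1) → k) :=
  Matrix.mulVecLin (fun (σ : Face L (c+1)) (τ : Face L c) => coeffD z τ.1 σ.1)

/-- The Aomoto--Betti number `β_i(k⟨L⟩, z)`, the dimension of the `i`-th cohomology
of the Aomoto complex `(k⟨L⟩, ·z)`. -/
noncomputable def aomotoBetti (k : Type) [Field k] (L : Finset (Finset V)) (z : V → k)
    (i : ℕ) : ℕ :=
  Module.finrank k (LinearMap.ker (aD k L z i)) -
    (match i with
     | 0 => 0
     | j+1 => Module.finrank k (LinearMap.range (aD k L z j)))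

/-- The canonical degree-one element `z_W = ∑_{v ∈ W} v*` of `k⟨L⟩`, as a weight vector. -/
def zW (k : Type) [Field k] (W : Finset V) : V → k := fun v => if v ∈ W then 1 else 0

/-- The Aomoto--Betti number `β_i(k⟨L⟩, W) = β_i(k⟨L⟩, z_W)`. -/
noncomputable def aomotoBettiW (k : Type) [Field k] (L : Finset (Finset V)) (W : Finset V)
    (i : ℕ) : ℕ :=
  aomotoBetti k L (zW k W) i

/-- The cycles in cardinality-degree `n` of the twisted chain complex `C_•(T_L, R_z)`
(in degree `0` every chain is a cycle). -/
noncomputable def cyc (R : Type) [CommRing R] (L : Finset (Finset V)) (z : V → R) :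
    (n : ℕ) → Submodule R (Face L n → R)
  | 0 => ⊤
  | (m+1) => LinearMap.ker (tB R L z m)

/-- `dim_k H_n(C_•(T_L, k_z))`, the dimension of the `n`-th twisted homology of the
toric complex `T_L` with coefficients in the rank-one system determined by `z`. -/
noncomputable def twHomDim (k : Type) [Field k] (L : Finset (Finset V)) (z : V → k)
    (n : ℕ) : ℕ :=
  Module.finrank k ↥(cyc k L z n) - Module.finrank k ↥(LinearMap.range (tB k L z n))

/-- `dim_k H̃_j(K; k)`, the `j`-th reduced simplicial homology of the complex `K`
(the chain complex of `K` including the empty face is exactly the twisted complex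
with all weights equal to `1`; the degree-`j` reduced homology sits in
cardinality-degree `j+1`). -/
noncomputable def reducedBetti (k : Type) [Field k] (K : Finset (Finset V)) (j : ℤ) : ℕ :=
  if j < -1 then 0 else twHomDim k K (fun _ => (1 : k)) (j+1).toNat

/-- The link `lk_{L_W}(σ) = {τ ∈ L_W ∣ τ ∪ σ ∈ L}` of a face `σ` in the induced
subcomplex `L_W`. -/
def linkIn (L : Finset (Finset V)) (W σ : Finset V) : Finset (Finset V) :=
  L.filter (fun τ => τ ⊆ W ∧ τ ∪ σ ∈ L)

/-- The `n`-th homology of the twisted chain complex `C_•(T_L, R_z)`, as an `R`-module. -/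
noncomputable abbrev twHomology (R : Type) [CommRing R] (L : Finset (Finset V)) (z : V → R)
    (n : ℕ) :=
  ↥(cyc R L z n) ⧸ (LinearMap.range (tB R L z n)).comap (cyc R L z n).subtype

namespace Matrix

/-- The rank of a matrix over a field is unchanged by extension of scalars. -/
theorem rank_map_algebraMap {k A m n : Type*} [Field k] [CommRing A] [Nontrivial A] [Algebra k A]
    [Fintype m] [Fintype n] (M : Matrix m n k) : (M.map (algebraMap k A)).rank = M.rank := by
  classical
  set f := M.mulVecLin with hf
  let e : LinearMap.range f ≃ₗ[k] (Fin M.rank → k) :=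
    (Module.finBasis k (LinearMap.range f)).equivFun
  let g : (n → k) →ₗ[k] (Fin M.rank → k) := e.toLinearMap ∘ₗ f.rangeRestrict
  let h : (Fin M.rank → k) →ₗ[k] (m → k) := (LinearMap.range f).subtype ∘ₗ e.symm.toLinearMap
  have hfac : h ∘ₗ g = f := by ext; simp [h, g]
  obtain ⟨g', hg'⟩ := g.exists_rightInverse_of_surjective <| by
    rw [LinearMap.range_eq_top]
    exact e.surjective.comp f.surjective_rangeRestrict
  obtain ⟨h', hh'⟩ := h.exists_leftInverse_of_injective <| by
    rw [LinearMap.ker_eq_bot]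
    exact Subtype.val_injective.comp e.symm.injective
  have hMf : M = LinearMap.toMatrix' f := by rw [hf, ← toLin'_apply', LinearMap.toMatrix'_toLin']
  have hM : M = LinearMap.toMatrix' h * LinearMap.toMatrix' g := by
    rw [← LinearMap.toMatrix'_comp, hfac, ← hMf]
  have hone : LinearMap.toMatrix' h' * M * LinearMap.toMatrix' g' = 1 := by
    have hMf' : M = LinearMap.toMatrix' (h ∘ₗ g) := by rw [hfac, ← hMf]
    rw [congrArg (LinearMap.toMatrix' h' * ·) hMf', ← LinearMap.toMatrix'_comp, ← LinearMap.toMatrix'_comp, ← LinearMap.comp_assoc, hh',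
      LinearMap.id_comp, hg', LinearMap.toMatrix'_id]
  apply le_antisymm
  · have : M.map (algebraMap k A) = (LinearMap.toMatrix' h).map (algebraMap k A) *
        (LinearMap.toMatrix' g).map (algebraMap k A) := by
      rw [← Matrix.map_mul, ← hM]
    rw [this]
    exact (rank_mul_le_left _ _).trans ((rank_le_card_width _).trans_eq (Fintype.card_fin _))
  · have key : (LinearMap.toMatrix' h').map (algebraMap k A) * M.map (algebraMap k A) *
        (LinearMap.toMatrix' g').map (algebraMap k A) = 1 := by
      rw [← Matrix.map_mul, ← Matrix.map_mul, hone, Matrix.map_one _ (map_zero _) (map_one _)]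
    calc M.rank = (1 : Matrix (Fin M.rank) (Fin M.rank) A).rank := by
          rw [rank_one, Fintype.card_fin]
      _ ≤ _ := by
          rw [← key]
          exact (rank_mul_le_left _ _).trans (rank_mul_le_right _ _)

end Matrix

section Incidence

variable {R : Type} [CommRing R]

theorem coeffD_insert {V : Type} [LinearOrder V] (z : V → R) {τ : Finset V} {v : V} (hv : v ∉ τ) :
    coeffD z τ (insert v τ) = (-1 : R) ^ (τ.filter (fun w => w < v)).card * z v := by
  rw [coeffD, if_pos (subset_insert v τ), insert_sdiff_cancel hv, sum_singleton]

theorem coeffD_eq_zero {V : Type} [LinearOrder V] (z : V → R) {τ σ : Finset V} (h : ¬ τ ⊆ σ) : coeffD z τ σ = 0 :=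
  if_neg h

theorem coeffD_mul_prod {V : Type} [LinearOrder V] (u w : V → R) {τ σ : Finset V}
    (h : σ.card = τ.card + 1) :
    (∏ v ∈ τ, u v) * coeffD (fun v => u v * w v) τ σ = coeffD w τ σ * ∏ v ∈ σ, u v := by
  by_cases hs : τ ⊆ σ
  · obtain ⟨v, hv, rfl⟩ := (Finset.covBy_iff_exists_insert (s := τ) (t := σ)).1
      (Finset.covBy_iff_card_sdiff_eq_one.2 ⟨hs, by rw [card_sdiff_of_subset hs]; omega⟩)
    rw [coeffD_insert _ hv, coeffD_insert _ hv, prod_insert hv]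
    ring
  · simp [coeffD_eq_zero _ hs]

theorem coeffD_coeffD_cancel {V : Type} [LinearOrder V] (z : V → R) {ρ : Finset V} {a b : V}
    (ha : a ∉ ρ) (hb : b ∉ ρ) (hab : a < b) :
    coeffD z ρ (insert a ρ) * coeffD z (insert a ρ) (insert a (insert b ρ)) +
      coeffD z ρ (insert b ρ) * coeffD z (insert b ρ) (insert a (insert b ρ)) = 0 := by
  have h1 : b ∉ insert a ρ := by simp [hb, hab.ne']
  have h2 : a ∉ insert b ρ := by simp [ha, hab.ne]
  rw [coeffD_insert _ ha, coeffD_insert _ hb, coeffD_insert _ h2, Finset.insert_comm,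
    coeffD_insert _ h1, filter_insert, if_pos hab, filter_insert, if_neg hab.not_gt,
    card_insert_of_notMem (by simp [ha])]
  ring

/-- The twisted boundary maps compose to zero. -/
theorem tB_comp_tB {L : Finset (Finset V)} (hL : IsCx L) (z : V → R) (c : ℕ) :
    tB R L z c ∘ₗ tB R L z (c + 1) = 0 := by
  classical
  let B (n : ℕ) : Matrix (Face L n) (Face L (n + 1)) R := fun τ σ => coeffD z τ.1 σ.1
  suffices h : B c * B (c + 1) = 0 by
    change (B c).mulVecLin ∘ₗ (B (c + 1)).mulVecLin = 0
    rw [← Matrix.mulVecLin_mul, h, Matrix.mulVecLin_zero]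
  ext ⟨ρ, hρL, hρ⟩ ⟨τ, hτL, hτ⟩
  rw [Matrix.mul_apply, Matrix.zero_apply]
  by_cases hs : ρ ⊆ τ
  · obtain ⟨a, b, hab, hd⟩ : ∃ a b, a < b ∧ τ \ ρ = {a, b} := by
      obtain ⟨a, b, hab, h⟩ := card_eq_two.1
        (show (τ \ ρ).card = 2 by rw [card_sdiff_of_subset hs]; omega)
      rcases hab.lt_or_gt with hlt | hlt
      · exact ⟨a, b, hlt, h⟩
      · exact ⟨b, a, hlt, by rw [h, pair_comm]⟩
    have ha : a ∉ ρ := (mem_sdiff.1 (by rw [hd]; simp : a ∈ τ \ ρ)).2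
    have hb : b ∉ ρ := (mem_sdiff.1 (by rw [hd]; simp : b ∈ τ \ ρ)).2
    have hτ' : τ = insert a (insert b ρ) := by
      rw [← sdiff_union_of_subset hs, hd]; simp
    subst hτ'
    have haL : insert a ρ ∈ L := hL.2 _ hτL _ (insert_subset_insert _ (subset_insert _ _))
    have hbL : insert b ρ ∈ L := hL.2 _ hτL _ (subset_insert _ _)
    let σa : Face L (c + 1) := ⟨insert a ρ, haL, by rw [card_insert_of_notMem ha, hρ]⟩
    let σb : Face L (c + 1) := ⟨insert b ρ, hbL, by rw [card_insert_of_notMem hb, hρ]⟩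
    have hne : σa ≠ σb := fun h => by
      have : a ∈ insert b ρ := by
        rw [← show insert a ρ = insert b ρ from congrArg Subtype.val h]; simp
      simp [hab.ne, ha] at this
    refine (Fintype.sum_eq_add σa σb hne ?_).trans (coeffD_coeffD_cancel z ha hb hab)
    rintro ⟨σ, hσL, hσ⟩ ⟨hna, hnb⟩
    change coeffD z ρ σ * coeffD z σ (insert a (insert b ρ)) = 0
    by_cases h1 : ρ ⊆ σ
    · by_cases h2 : σ ⊆ insert a (insert b ρ)
      · exfalso
        obtain ⟨v, hv, rfl⟩ := (Finset.covBy_iff_exists_insert (s := ρ) (t := σ)).1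
          (Finset.covBy_iff_card_sdiff_eq_one.2 ⟨h1, by rw [card_sdiff_of_subset h1]; omega⟩)
        have hv' := h2 (mem_insert_self v ρ)
        simp only [mem_insert, hv, or_false] at hv'
        rcases hv' with rfl | rfl
        · exact hna rfl
        · exact hnb rfl
      · simp [coeffD_eq_zero _ h2]
    · simp [coeffD_eq_zero _ h1]
  · refine Finset.sum_eq_zero fun σ _ => ?_
    change coeffD z ρ σ.1 * coeffD z σ.1 τ = 0
    by_cases h1 : ρ ⊆ σ.1
    · rw [coeffD_eq_zero _ fun h2 => hs (h1.trans h2), mul_zero]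
    · rw [coeffD_eq_zero _ h1, zero_mul]

theorem range_tB_le_cyc {L : Finset (Finset V)} (hL : IsCx L) (z : V → R) (i : ℕ) :
    LinearMap.range (tB R L z i) ≤ cyc R L z i := by
  cases i with
  | zero => exact le_top
  | succ j => exact LinearMap.range_le_ker_iff.2 (tB_comp_tB hL z j)

theorem finrank_cyc [IsDomain R] (L : Finset (Finset V)) (z : V → R) (i : ℕ) :
    Module.finrank R (cyc R L z i) = Fintype.card (Face L i) -
      (match i with
       | 0 => 0
       | j + 1 => Module.finrank R (LinearMap.range (tB R L z j))) := by
  cases i with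
  | zero => exact finrank_top _ _ |>.trans (Module.finrank_pi R)
  | succ j =>
    have := Submodule.finrank_quotient_add_finrank (LinearMap.ker (tB R L z j))
    rw [(tB R L z j).quotKerEquivRange.finrank_eq, Module.finrank_pi] at this
    exact Nat.eq_sub_of_add_eq' this

theorem rank_twHomology [IsDomain R] [IsNoetherianRing R] {L : Finset (Finset V)} (hL : IsCx L)
    (z : V → R) (i : ℕ) :
    Module.rank R (twHomology R L z i) =
      ((Module.finrank R (cyc R L z i) -
        Module.finrank R (LinearMap.range (tB R L z i)) : ℕ) : Cardinal) := by
  rw [← Module.finrank_eq_rank, Nat.cast_inj]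
  have := Submodule.finrank_quotient_add_finrank
    ((LinearMap.range (tB R L z i)).comap (cyc R L z i).subtype)
  rw [(Submodule.comapSubtypeEquivOfLe (range_tB_le_cyc hL z i)).finrank_eq] at this
  exact Nat.eq_sub_of_add_eq this

/-- Rescaling the weights by nonzero factors does not change the ranks of the boundary maps. -/
theorem finrank_range_tB_mul [IsDomain R] (L : Finset (Finset V)) (u w : V → R)
    (hu : ∀ v, u v ≠ 0) (c : ℕ) :
    Module.finrank R (LinearMap.range (tB R L (fun v => u v * w v) c)) =
      Module.finrank R (LinearMap.range (tB R L w c)) := by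
  classical
  let B (z : V → R) : Matrix (Face L c) (Face L (c + 1)) R := fun τ σ => coeffD z τ.1 σ.1
  let D (n : ℕ) : Matrix (Face L n) (Face L n) R := Matrix.diagonal fun σ => ∏ v ∈ σ.1, u v
  have hD (n : ℕ) : (D n).det ≠ 0 := by
    rw [Matrix.det_diagonal]
    exact Finset.prod_ne_zero_iff.2 fun σ _ => Finset.prod_ne_zero_iff.2 fun v _ => hu v
  have hDB : D c * B (fun v => u v * w v) = B w * D (c + 1) := by
    ext τ σ
    rw [Matrix.diagonal_mul, Matrix.mul_diagonal]
    exact coeffD_mul_prod u w (by rw [σ.2.2, τ.2.2])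
  change (B fun v => u v * w v).rank = (B w).rank
  rw [← Matrix.rank_mul_eq_right_of_det_ne_zero _ _ (hD c), hDB,
    Matrix.rank_mul_eq_left_of_det_ne_zero _ _ (hD (c + 1))]

end Incidence

theorem coeffD_algebraMap {V : Type} [LinearOrder V] {k A : Type} [CommRing k] [CommRing A]
    [Algebra k A] (w : V → k) (τ σ : Finset V) :
    coeffD (fun v => algebraMap k A (w v)) τ σ = algebraMap k A (coeffD w τ σ) := by
  unfold coeffD
  split_ifs <;> simp

/-- Extending scalars from a field, the boundary maps and the Aomoto differentials have equal
ranks. -/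
theorem finrank_range_tB_algebraMap {k A : Type} [Field k] [CommRing A] [Nontrivial A]
    [Algebra k A] (L : Finset (Finset V)) (w : V → k) (c : ℕ) :
    Module.finrank A (LinearMap.range (tB A L (fun v => algebraMap k A (w v)) c)) =
      Module.finrank k (LinearMap.range (aD k L w c)) := by
  let B : Matrix (Face L c) (Face L (c + 1)) k := fun τ σ => coeffD w τ.1 σ.1
  have h : tB A L (fun v => algebraMap k A (w v)) c =
      (B.map (algebraMap k A)).mulVecLin := by
    unfold tB
    congr 1
    ext τ σ
    exact coeffD_algebraMap w τ.1 σ.1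
  rw [h]
  exact (Matrix.rank_map_algebraMap B).trans B.rank_transpose.symm

theorem LaurentPolynomial.T_sub_one_ne_zero {k : Type*} [Ring k] [Nontrivial k] {n : ℤ}
    (hn : n ≠ 0) : (T n - 1 : LaurentPolynomial k) ≠ 0 := by
  rw [sub_ne_zero, ← T_zero]
  exact fun h => hn (AddMonoidAlgebra.of_injective (R := k) h)

instance LaurentPolynomial.isNoetherianRing (k : Type*) [Field k] :
    IsNoetherianRing (LaurentPolynomial k) :=
  IsLocalization.isNoetherianRing (Submonoid.powers (Polynomial.X : Polynomial k)) _ inferInstance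

open LaurentPolynomial in
/-- For an epimorphism `χ : G_L ↠ ℤ` given by weights `m_v` with
`gcd = 1`, the `k[t,t⁻¹]`-rank of `H_i(T_L^χ; k) = H_i(C_•(T_L, Λ_γ))`, where
`γ_v = t^{m_v} − 1`, equals `β_i(k⟨L⟩, V_0(χ))` for all `i ≥ 0`, where
`V_0(χ) = {v : m_v ≠ 0}` is the support of `χ`. -/
theorem statement11 {V : Type} [Fintype V] [LinearOrder V] (k : Type) [Field k]
    (L : Finset (Finset V)) (hL : IsCx L) (hV : ∀ v : V, {v} ∈ L)
    (m : V → ℤ) (hgcd : Finset.univ.gcd m = 1) :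
    ∀ i : ℕ,
      Module.rank (LaurentPolynomial k)
          (twHomology (LaurentPolynomial k) L (fun v => T (m v) - 1) i) =
        (aomotoBettiW k L (Finset.univ.filter (fun v => m v ≠ 0)) i : Cardinal) := by
  intro i
  have hrange (c : ℕ) : Module.finrank (LaurentPolynomial k)
      (LinearMap.range (tB (LaurentPolynomial k) L (fun v => T (m v) - 1) c)) =
      Module.finrank k
        (LinearMap.range (aD k L (zW k (Finset.univ.filter fun v => m v ≠ 0)) c)) := by
    have hu : ∀ v, (if m v = 0 then 1 else T (m v) - 1 : LaurentPolynomial k) ≠ 0 := by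
      intro v
      split_ifs with hv
      · exact one_ne_zero
      · exact LaurentPolynomial.T_sub_one_ne_zero hv
    rw [← finrank_range_tB_algebraMap (A := LaurentPolynomial k),
      ← finrank_range_tB_mul L _ (fun v => algebraMap k (LaurentPolynomial k) _) hu]
    have hγ : (fun v => T (m v) - 1 : V → LaurentPolynomial k) = fun v =>
        (if m v = 0 then 1 else T (m v) - 1) * algebraMap k (LaurentPolynomial k)
          (zW k (Finset.univ.filter fun v => m v ≠ 0) v) := by
      ext1 v
      by_cases hv : m v = 0 <;> simp [zW, hv]
    rw [hγ]
  have hker := LinearMap.finrank_range_add_finrank_ker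
    (aD k L (zW k (Finset.univ.filter fun v => m v ≠ 0)) i)
  rw [Module.finrank_pi] at hker
  rw [rank_twHomology hL, finrank_cyc, hrange, Nat.cast_inj]
  unfold aomotoBettiW aomotoBetti
  cases i with
  | zero => dsimp only at hker ⊢; omega
  | succ j => dsimp only at hker ⊢; rw [hrange]; omega
end

section
/- Let L be a finite simplicial complex on vertex set V, k a field, m : V → ℤ weights with gcd 1, Λ = k[t, t^{−1}], and γ_v = t^{m_v} − 1. Let f ∈ k[t] be irreducible and different from t. If for every vertex v with m_v ≠ 0 the polynomial f does not divide t^{m_v} − 1, then for every i the Λ-module H_i(C_•(T_L, Λ_γ)) has trivial f-primary part, i.e., its f-torsion submodule is zero. -/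
open Finset

variable {V : Type} [Fintype V] [LinearOrder V]

/-- A linear map between vector spaces has a generalized inverse. -/
theorem LinearMap.exists_generalizedInverse {k M N : Type*} [Field k] [AddCommGroup M]
    [Module k M] [AddCommGroup N] [Module k N] (f : M →ₗ[k] N) :
    ∃ g : N →ₗ[k] M, f ∘ₗ g ∘ₗ f = f := by
  obtain ⟨p, hp⟩ := f.rangeRestrict.exists_rightInverse_of_surjective f.range_rangeRestrict
  obtain ⟨g, hg⟩ := p.exists_extend
  refine ⟨g, LinearMap.ext fun x => ?_⟩
  have h1 : g (f x) = p (f.rangeRestrict x) := LinearMap.congr_fun hg (f.rangeRestrict x)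
  have h2 : f.rangeRestrict (p (f.rangeRestrict x)) = f.rangeRestrict x :=
    LinearMap.congr_fun hp _
  simpa [h1] using congrArg Subtype.val h2

/-- A matrix over a field has a generalized inverse. -/
theorem Matrix.exists_generalizedInverse {k ι κ : Type*} [Field k] [Fintype ι] [Fintype κ]
    (A : Matrix ι κ k) : ∃ B : Matrix κ ι k, A * B * A = A := by
  classical
  obtain ⟨g, hg⟩ := (Matrix.toLin' A).exists_generalizedInverse
  refine ⟨LinearMap.toMatrix' g, Matrix.toLin'.injective ?_⟩
  rw [Matrix.toLin'_mul, Matrix.toLin'_mul, Matrix.toLin'_toMatrix', LinearMap.comp_assoc, hg]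

/-- Over a domain, the range of a matrix with entries in a field is saturated. -/
theorem Matrix.exists_mulVec_eq_of_smul_eq_mulVec {k R ι κ : Type*} [Field k] [CommRing R]
    [IsDomain R] [Fintype ι] [Fintype κ] (φ : k →+* R) (A : Matrix ι κ k) {r : R} (hr : r ≠ 0)
    {a : ι → R} {b : κ → R} (h : r • a = (A.map φ).mulVec b) : ∃ b' : κ → R, a = (A.map φ).mulVec b' := by
  obtain ⟨B, hB⟩ := A.exists_generalizedInverse
  have hB' : A.map φ * B.map φ * A.map φ = A.map φ := by
    rw [← Matrix.map_mul, ← Matrix.map_mul, hB]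
  refine ⟨(B.map φ).mulVec a, smul_right_injective (ι → R) hr ?_⟩
  change r • a = r • _
  rw [← Matrix.mulVec_smul, ← Matrix.mulVec_smul, h, Matrix.mulVec_mulVec, Matrix.mulVec_mulVec, hB']

theorem map_coeffD {W R S : Type} [LinearOrder W] [CommRing R] [CommRing S] (φ : R →+* S)
    (z : W → R) (τ σ : Finset W) : φ (coeffD z τ σ) = coeffD (fun v => φ (z v)) τ σ := by
  unfold coeffD
  split_ifs <;> simp

/-- For faces of consecutive cardinalities, the incidence coefficient is either zero or given by
the unique vertex of the larger face missing from the smaller one. -/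
theorem coeffD_eq_zero_or {W : Type} [LinearOrder W] {c : ℕ} {τ σ : Finset W} (hτ : τ.card = c)
    (hσ : σ.card = c + 1) :
    (∀ {R : Type} [CommRing R] (z : W → R), coeffD z τ σ = 0) ∨
      ∃ v ∉ τ, σ = insert v τ ∧ ∀ {R : Type} [CommRing R] (z : W → R),
        coeffD z τ σ = (-1) ^ (τ.filter (fun w => w < v)).card * z v := by
  by_cases h : τ ⊆ σ
  · right
    obtain ⟨v, hv⟩ := Finset.card_eq_one.1
      (show (σ \ τ).card = 1 by rw [Finset.card_sdiff_of_subset h]; lia)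
    have hvm : v ∈ σ \ τ := by simp [hv]
    refine ⟨v, (Finset.mem_sdiff.1 hvm).2, ?_, fun z => by simp [coeffD, h, hv]⟩
    rw [Finset.insert_eq, ← hv, Finset.sdiff_union_of_subset h]
  · exact Or.inl fun z => by simp [coeffD, h]

section Rescaling

variable {R : Type} [CommRing R] (L : Finset (Finset V)) (e d : V → R)

theorem tB_apply (z : V → R) (c : ℕ) (x : Face L (c + 1) → R) (τ : Face L c) :
    tB R L z c x τ = ∑ σ, coeffD z τ.1 σ.1 * x σ := rfl

/-- Scaling each face by the product of `d` over its vertices is a chain map from the complex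
with weights `e * d` to the complex with weights `e`. -/
theorem prod_mul_tB (c : ℕ) (x : Face L (c + 1) → R) :
    (fun τ : Face L c => (∏ v ∈ τ.1, d v) * tB R L (fun v => e v * d v) c x τ) =
      tB R L e c (fun σ => (∏ v ∈ σ.1, d v) * x σ) := by
  funext τ
  simp only [tB_apply, Finset.mul_sum]
  refine Finset.sum_congr rfl fun σ _ => ?_
  obtain h | ⟨v, hv, hσ, h⟩ := coeffD_eq_zero_or τ.2.2 σ.2.2
  · simp [h]
  · rw [h, h, hσ, Finset.prod_insert hv]
    ring

/-- Scaling each face by the product of `d` over the complementary vertices is a chain map from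
the complex with weights `e` to the complex with weights `e * d`. -/
theorem prod_compl_mul_tB (c : ℕ) (x : Face L (c + 1) → R) :
    (fun τ : Face L c => (∏ v ∈ τ.1ᶜ, d v) * tB R L e c x τ) =
      tB R L (fun v => e v * d v) c (fun σ => (∏ v ∈ σ.1ᶜ, d v) * x σ) := by
  funext τ
  simp only [tB_apply, Finset.mul_sum]
  refine Finset.sum_congr rfl fun σ _ => ?_
  obtain h | ⟨v, hv, hσ, h⟩ := coeffD_eq_zero_or τ.2.2 σ.2.2
  · simp [h]
  · rw [h, h, hσ, Finset.compl_insert,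
      ← Finset.mul_prod_erase _ _ (Finset.mem_compl.2 hv)]
    ring

end Rescaling

/-- If the weights are products of constants and a function `d`, then an element some multiple of
which by `r ≠ 0` coprime to `∏ v, d v` lies in the image of the boundary is itself a boundary. -/
theorem mem_range_tB_of_smul_mem {k R : Type} [Field k] [CommRing R] [IsDomain R] (φ : k →+* R)
    (L : Finset (Finset V)) {z : V → R} (e : V → k) (d : V → R) (hz : ∀ v, z v = φ (e v) * d v)
    (c : ℕ) {r : R} (hr : r ≠ 0) (hrd : IsCoprime r (∏ v, d v)) {x : Face L c → R}
    (hx : r • x ∈ LinearMap.range (tB R L z c)) : x ∈ LinearMap.range (tB R L z c) := by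
  obtain rfl : z = fun v => φ (e v) * d v := funext hz
  obtain ⟨a, b, hab⟩ := hrd
  rw [← one_smul R x, ← hab, add_smul, mul_smul, mul_smul]
  refine add_mem (Submodule.smul_mem _ _ hx) (Submodule.smul_mem _ _ ?_)
  obtain ⟨y, hy⟩ := hx
  let A : Matrix (Face L c) (Face L (c + 1)) k := fun τ σ => coeffD e τ.1 σ.1
  have hA (w : Face L (c + 1) → R) : tB R L (fun v => φ (e v)) c w = (A.map φ).mulVec w := by
    funext τ
    rw [tB_apply]
    exact Finset.sum_congr rfl fun σ _ =>
      congrArg (· * w σ) (map_coeffD φ e τ.1 σ.1).symm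
  have key := prod_mul_tB L (fun v => φ (e v)) d c y
  rw [hy, hA] at key
  obtain ⟨w, hw⟩ := A.exists_mulVec_eq_of_smul_eq_mulVec φ hr
    (a := fun τ => (∏ v ∈ τ.1, d v) * x τ) (by
      rw [← key]
      funext τ
      simp only [Pi.smul_apply, smul_eq_mul]
      ring)
  rw [← hA] at hw
  refine ⟨_, (prod_compl_mul_tB L (fun v => φ (e v)) d c w).symm.trans ?_⟩
  rw [← hw]
  funext τ
  simp only [Pi.smul_apply, smul_eq_mul]
  rw [← mul_assoc, Finset.prod_compl_mul_prod]

open LaurentPolynomial in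
/-- An irreducible polynomial is coprime to every Laurent polynomial it does not divide. -/
theorem Irreducible.isCoprime_toLaurent {k : Type*} [Field k] {f : Polynomial k}
    (hf : Irreducible f) {p : LaurentPolynomial k} (hp : ¬ Polynomial.toLaurent f ∣ p) :
    IsCoprime (Polynomial.toLaurent f) p := by
  obtain ⟨n, q, hq⟩ := p.exists_T_pow
  have hfq : ¬ f ∣ q := fun h => hp <| by
    rw [← (isUnit_T (R := k) n).dvd_mul_right, ← hq]
    exact map_dvd Polynomial.toLaurent h
  have := (hf.coprime_iff_not_dvd.2 hfq).map Polynomial.toLaurent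
  rw [hq] at this
  exact this.of_mul_right_left

open LaurentPolynomial in
/-- Let `f ∈ k[t]` be irreducible and different from `t`.  If `f`
does not divide `t^{m_v} − 1` for any vertex `v` with `m_v ≠ 0`, then for every `i`
the `k[t,t⁻¹]`-module `H_i(T_L^χ; k) = H_i(C_•(T_L, Λ_γ))`, `γ_v = t^{m_v} − 1`, has
trivial `f`-primary part: no nonzero element is annihilated by a power of `f`. -/
theorem statement13 {V : Type} [Fintype V] [LinearOrder V] (k : Type) [Field k]
    (L : Finset (Finset V)) (hL : IsCx L) (hV : ∀ v : V, {v} ∈ L)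
    (m : V → ℤ) (hgcd : Finset.univ.gcd m = 1)
    (f : Polynomial k) (hf : Irreducible f) (hfX : f ≠ Polynomial.X)
    (hdvd : ∀ v : V, m v ≠ 0 → ¬ (Polynomial.toLaurent f ∣ (T (m v) - 1))) :
    ∀ i : ℕ, ∀ x : twHomology (LaurentPolynomial k) L (fun v => T (m v) - 1) i,
      ∀ n : ℕ, (Polynomial.toLaurent f) ^ n • x = 0 → x = 0 := by
  intro i x n hx
  obtain ⟨x, rfl⟩ := Submodule.Quotient.mk_surjective _ x
  rw [← Submodule.Quotient.mk_smul, Submodule.Quotient.mk_eq_zero, Submodule.mem_comap] at hx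
  rw [Submodule.Quotient.mk_eq_zero, Submodule.mem_comap]
  let e : V → k := fun v => if m v = 0 then 0 else 1
  let d : V → LaurentPolynomial k := fun v => if m v = 0 then 1 else T (m v) - 1
  have hz (v : V) : (T (m v) - 1 : LaurentPolynomial k) = C (e v) * d v := by
    by_cases h : m v = 0 <;> simp [e, d, h]
  have hcop : IsCoprime (Polynomial.toLaurent f ^ n) (∏ v, d v) := by
    refine IsCoprime.prod_right fun v _ => IsCoprime.pow_left ?_
    by_cases h : m v = 0
    · simpa [d, h] using isCoprime_one_right
    · simpa [d, h] using hf.isCoprime_toLaurent (hdvd v h)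
  have hne : Polynomial.toLaurent f ^ n ≠ 0 :=
    pow_ne_zero _ ((map_ne_zero_iff _ Polynomial.toLaurent_injective).2 hf.ne_zero)
  exact mem_range_tB_of_smul_mem C L e d hz i hne hcop hx
end
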